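/- arXiv:2103.07648 — 2 statements merged into one kernel-verified Lean document; each statement's English description precedes it below -/
import Mathlib

section
/- For the Lie algebra 𝔤₄,₁₂, the almost Hermitian structure (J₁,g) belongs to the Gray–Hervella class W₄: for all x,y,z ∈ V, F₁(x,y,z) = ½{ g(x,y)θ₁(z) − g(x,J₁y)θ₁(J₁z) − g(x,z)θ₁(y) + g(x,J₁z)θ₁(J₁y) }, where the Lee form satisfies θ₁(e₄) = −2 and θ₁(e₁) = θ₁(e₂) = θ₁(e₃) = 0; moreover θ₁ ≠ 0, so the structure is not Kähler. -/
noncomputable section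

/-- The underlying 4-dimensional real vector space. -/
abbrev V : Type := Fin 4 → ℝ

/-- The standard basis e₁,e₂,e₃,e₄ (indexed by 0,1,2,3). -/
def e (i : Fin 4) : V := Pi.single i 1

/-- The neutral metric g with g(e₁,e₁)=g(e₂,e₂)=1, g(e₃,e₃)=g(e₄,e₄)=−1. -/
def gm (x y : V) : ℝ := x 0 * y 0 + x 1 * y 1 - x 2 * y 2 - x 3 * y 3

/-- The signs ε₁=ε₂=1, ε₃=ε₄=−1. -/
def eps : Fin 4 → ℝ := ![1, 1, -1, -1]

/-- J₁ : e₁↦e₂, e₂↦−e₁, e₃↦−e₄, e₄↦e₃. -/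
def J1 (x : V) : V := ![-x 1, x 0, x 3, -x 2]

/-- J₂ : e₁↦e₃, e₂↦e₄, e₃↦−e₁, e₄↦−e₂. -/
def J2 (x : V) : V := ![-x 2, -x 3, x 0, x 1]

/-- J₃ : e₁↦−e₄, e₂↦e₃, e₃↦−e₂, e₄↦e₁. -/
def J3 (x : V) : V := ![x 3, -x 2, x 1, -x 0]

/-- Lie bracket of 𝔤₄,₁₂ : [e₁,e₃]=e₁, [e₁,e₄]=−e₂, [e₂,e₃]=e₂, [e₂,e₄]=e₁. -/
def br (x y : V) : V :=
  ![(x 0 * y 2 - x 2 * y 0) + (x 1 * y 3 - x 3 * y 1),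
    -(x 0 * y 3 - x 3 * y 0) + (x 1 * y 2 - x 2 * y 1), 0, 0]

/-- Fundamental tensor F(x,y,z) = g((∇ₓ J)y, z) for an almost complex structure Jm. -/
def Fa (nab : V →ₗ[ℝ] V →ₗ[ℝ] V) (Jm : V → V) (x y z : V) : ℝ :=
  gm (nab x (Jm y) - Jm (nab x y)) z

/-- Lee form θ(z) = Σᵢ εᵢ F(eᵢ,eᵢ,z). -/
def theta (nab : V →ₗ[ℝ] V →ₗ[ℝ] V) (Jm : V → V) : V → ℝ :=
  fun z => ∑ i, eps i * Fa nab Jm (e i) (e i) z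

/-- Curvature operator R(x,y)z = ∇ₓ∇_y z − ∇_y∇ₓ z − ∇_{[x,y]} z. -/
def Rm (nab : V →ₗ[ℝ] V →ₗ[ℝ] V) (x y z : V) : V :=
  nab x (nab y z) - nab y (nab x z) - nab (br x y) z

/-- Curvature (0,4)-tensor R(x,y,z,w) = g(R(x,y)z, w). -/
def R4 (nab : V →ₗ[ℝ] V →ₗ[ℝ] V) (x y z w : V) : ℝ := gm (Rm nab x y z) w

/-- Ricci tensor ρ(y,z) = Σᵢ εᵢ R(eᵢ,y,z,eᵢ). -/
def ricci (nab : V →ₗ[ℝ] V →ₗ[ℝ] V) (y z : V) : ℝ :=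
  ∑ i, eps i * R4 nab (e i) y z (e i)

/-- Scalar curvature τ = Σⱼ εⱼ ρ(eⱼ,eⱼ). -/
def tau (nab : V →ₗ[ℝ] V →ₗ[ℝ] V) : ℝ := ∑ j, eps j * ricci nab (e j) (e j)

/-- Associated Ricci tensor ρ*(y,z) = Σᵢ εᵢ R(eᵢ,y,z,J eᵢ). -/
def ricciS (nab : V →ₗ[ℝ] V →ₗ[ℝ] V) (Jm : V → V) (y z : V) : ℝ :=
  ∑ i, eps i * R4 nab (e i) y z (Jm (e i))

/-- ∗-scalar curvature τ* = Σⱼ εⱼ ρ*(eⱼ,eⱼ). -/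
def tauS (nab : V →ₗ[ℝ] V →ₗ[ℝ] V) (Jm : V → V) : ℝ :=
  ∑ j, eps j * ricciS nab Jm (e j) (e j)

/-- ∗∗-scalar curvature τ** = Σⱼ εⱼ ρ*(eⱼ,J eⱼ). -/
def tauSS (nab : V →ₗ[ℝ] V →ₗ[ℝ] V) (Jm : V → V) : ℝ :=
  ∑ j, eps j * ricciS nab Jm (e j) (Jm (e j))

/-- Basic sectional curvature k_{ij} = R(eᵢ,eⱼ,eⱼ,eᵢ)/(εᵢεⱼ). -/
def sek (nab : V →ₗ[ℝ] V →ₗ[ℝ] V) (i j : Fin 4) : ℝ :=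
  R4 nab (e i) (e j) (e j) (e i) / (eps i * eps j)

/-- Antisymmetrized Kronecker symbol used to encode curvature-type tensors. -/
def D (a b i j : Fin 4) : ℝ :=
  (if i = a ∧ j = b then (1 : ℝ) else 0) - (if i = b ∧ j = a then (1 : ℝ) else 0)

theorem gm_J1_left (x y : V) : gm (J1 x) y = -gm x (J1 y) := by
  simp [gm, J1]
  ring

theorem gm_sub_left (x y z : V) : gm (x - y) z = gm x z - gm y z := by
  simp [gm]
  ring

/-- The Koszul formula expresses the fundamental tensor of `J1` through the bracket alone. -/
theorem two_mul_Fa_J1 (nab : V →ₗ[ℝ] V →ₗ[ℝ] V)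
    (hK : ∀ x y z : V, 2 * gm (nab x y) z = gm (br x y) z + gm (br z x) y + gm (br z y) x)
    (x y z : V) :
    2 * Fa nab J1 x y z =
      gm (br x (J1 y)) z + gm (br z x) (J1 y) + gm (br z (J1 y)) x +
        (gm (br x y) (J1 z) + gm (br (J1 z) x) y + gm (br (J1 z) y) x) := by
  rw [← hK, ← hK, Fa, gm_sub_left, gm_J1_left]
  ring

theorem theta_J1 (nab : V →ₗ[ℝ] V →ₗ[ℝ] V)
    (hK : ∀ x y z : V, 2 * gm (nab x y) z = gm (br x y) z + gm (br z x) y + gm (br z y) x)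
    (z : V) : theta nab J1 z = -2 * z 3 := by
  have h (i : Fin 4) := two_mul_Fa_J1 nab hK (e i) (e i) z
  have h0 := h 0
  have h1 := h 1
  have h2 := h 2
  have h3 := h 3
  simp [gm, br, J1, e] at h0 h1 h2 h3
  simp [theta, Fin.sum_univ_four, eps, e]
  linarith

theorem stmt_18
    (nab : V →ₗ[ℝ] V →ₗ[ℝ] V)
    (hK : ∀ x y z : V, 2 * gm (nab x y) z = gm (br x y) z + gm (br z x) y + gm (br z y) x) :
    (∀ x y z : V, Fa nab J1 x y z =
      (1/2) * (gm x y * theta nab J1 z - gm x (J1 y) * theta nab J1 (J1 z)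
        - gm x z * theta nab J1 y + gm x (J1 z) * theta nab J1 (J1 y))) ∧
    theta nab J1 (e 3) = -2 ∧
    theta nab J1 (e 0) = 0 ∧ theta nab J1 (e 1) = 0 ∧ theta nab J1 (e 2) = 0 ∧
    theta nab J1 ≠ 0
  := by
    have hθ := theta_J1 nab hK
    refine ⟨fun x y z => ?_, ?_, ?_, ?_, ?_, fun h => ?_⟩
    · have h := two_mul_Fa_J1 nab hK x y z
      simp only [hθ]
      simp [gm, br, J1] at h ⊢
      linarith
    · simp [hθ, e]
    · simp [hθ, e]
    · simp [hθ, e]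
    · simp [hθ, e]
    · have h3 := congrFun h (e 3)
      simp [hθ, e] at h3
end
end

section
/- For the Lie algebra 𝔤₄,₁₂: the curvature tensor satisfies R₁₂₁₂ = −1, R₁₃₁₃ = 1, R₂₃₂₃ = 1, all other components vanishing except those determined from these via the symmetries R(x,y,z,w) = −R(y,x,z,w) = −R(x,y,w,z) = R(z,w,x,y) (in particular R ≠ 0, i.e. the manifold is non-flat); the Ricci tensor satisfies ρ(e₁,e₁) = ρ(e₂,e₂) = 2, ρ(e₃,e₃) = −2, ρ(e₄,e₄) = 0; the scalar curvature is positive, τ = 6; the ∗-scalar curvatures vanish, τ₁* = τ₂* = τ₃* = 0; the ∗∗-scalar curvatures are τ₁** = τ₂** = τ₃** = 2; and the basic sectional curvatures are k₁₂ = k₁₃ = k₂₃ = 1, k₁₄ = k₂₄ = k₃₄ = 0. -/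
noncomputable section

/-- The expected curvature tensor of 𝔤₄,₁₂ : nonzero components generated by
R₁₂₁₂=−1, R₁₃₁₃=1, R₂₃₂₃=1 and the symmetries
R(x,y,z,w) = −R(y,x,z,w) = −R(x,y,w,z) = R(z,w,x,y). -/
def T (i j k l : Fin 4) : ℝ :=
  -(D 0 1 i j * D 0 1 k l) + D 0 2 i j * D 0 2 k l + D 1 2 i j * D 1 2 k l

/-- The Koszul formula determines the connection in coordinates. -/
lemma nab_eq (nab : V →ₗ[ℝ] V →ₗ[ℝ] V)
    (hK : ∀ x y z : V, 2 * gm (nab x y) z = gm (br x y) z + gm (br z x) y + gm (br z y) x)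
    (x y : V) :
    nab x y = ![x 0 * y 2 - x 3 * y 1, x 1 * y 2 + x 3 * y 0, x 0 * y 0 + x 1 * y 1, 0] := by
  have h (i : Fin 4) := hK x y (e i)
  ext i
  have hi := h i
  fin_cases i <;> simp [gm, br, e] at hi ⊢ <;> linarith

/-- The restriction of the metric to the span of e₁, e₂, e₃, extended by zero on e₄. -/
def gmRestrict (x y : V) : ℝ := x 0 * y 0 + x 1 * y 1 - x 2 * y 2

/-- The curvature is that of constant sectional curvature 1 for the degenerate form
`gmRestrict`. -/
lemma R4_eq (nab : V →ₗ[ℝ] V →ₗ[ℝ] V)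
    (hK : ∀ x y z : V, 2 * gm (nab x y) z = gm (br x y) z + gm (br z x) y + gm (br z y) x)
    (x y z w : V) :
    R4 nab x y z w =
      gmRestrict y z * gmRestrict x w - gmRestrict x z * gmRestrict y w := by
  simp only [R4, Rm, nab_eq nab hK]
  simp [gm, br, gmRestrict]
  ring

theorem stmt_19
    (nab : V →ₗ[ℝ] V →ₗ[ℝ] V)
    (hK : ∀ x y z : V, 2 * gm (nab x y) z = gm (br x y) z + gm (br z x) y + gm (br z y) x) :
    R4 nab (e 0) (e 1) (e 0) (e 1) = -1 ∧
    R4 nab (e 0) (e 2) (e 0) (e 2) = 1 ∧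
    R4 nab (e 1) (e 2) (e 1) (e 2) = 1 ∧
    (∀ i j k l : Fin 4, R4 nab (e i) (e j) (e k) (e l) = T i j k l) ∧
    (∃ x y z w : V, R4 nab x y z w ≠ 0) ∧
    ricci nab (e 0) (e 0) = 2 ∧ ricci nab (e 1) (e 1) = 2 ∧
    ricci nab (e 2) (e 2) = -2 ∧ ricci nab (e 3) (e 3) = 0 ∧
    tau nab = 6 ∧ 0 < tau nab ∧
    tauS nab J1 = 0 ∧ tauS nab J2 = 0 ∧ tauS nab J3 = 0 ∧
    tauSS nab J1 = 2 ∧ tauSS nab J2 = 2 ∧ tauSS nab J3 = 2 ∧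
    sek nab 0 1 = 1 ∧ sek nab 0 2 = 1 ∧ sek nab 1 2 = 1 ∧
    sek nab 0 3 = 0 ∧ sek nab 1 3 = 0 ∧ sek nab 2 3 = 0
  := by
    have hR := R4_eq nab hK
    have h01 : R4 nab (e 0) (e 1) (e 0) (e 1) = -1 := by
      simp [hR, gmRestrict, e]
    have htau : tau nab = 6 := by
      simp [tau, ricci, hR, gmRestrict, e, eps, Fin.sum_univ_four]
      norm_num
    refine ⟨h01, ?_, ?_, ?_, ⟨e 0, e 1, e 0, e 1, by rw [h01]; norm_num⟩,
      ?_, ?_, ?_, ?_, htau, by rw [htau]; norm_num, ?_⟩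
    · simp [hR, gmRestrict, e]
    · simp [hR, gmRestrict, e]
    · intro i j k l
      rw [hR]
      fin_cases i <;> fin_cases j <;> fin_cases k <;> fin_cases l <;>
        simp [gmRestrict, e, T, D]
    iterate 4
      · simp [ricci, hR, gmRestrict, e, eps, Fin.sum_univ_four] <;> norm_num
    refine ⟨?_, ?_, ?_, ?_, ?_, ?_, ?_⟩
    iterate 6
      · simp [tauS, tauSS, ricciS, hR, gmRestrict, e, eps, J1, J2, J3, Fin.sum_univ_four] <;>
          norm_num
    · simp [sek, hR, gmRestrict, e, eps]
end
end
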